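/- arXiv:2305.20008 — 2 statements merged into one kernel-verified Lean document; each statement's English description precedes it below -/
import Mathlib

section
/- Let q be a prime power and n ≥ 1. The number of ordered pairs (f, g) with f, g ∈ F_q[X] monic, deg f < n, deg g = n, and gcd(f, g) = 1 equals q^{2n-1}. -/
open Polynomial

section EuclideanCounting

variable {F : Type*} [Field F]

/-- A pair of coprime monic polynomials of degrees `m ≤ n` amounts to the divisor, its remainder
and its quotient in the Euclidean division. -/
noncomputable def coprimeMonicPairsEquivDivMod {m n : ℕ} (hmn : m < n) :
    {P : F[X] × F[X] // P.1.Monic ∧ P.2.Monic ∧ P.1.natDegree = m ∧ P.2.natDegree = n ∧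
      IsCoprime P.1 P.2} ≃
    {P : F[X] × F[X] // P.1.Monic ∧ P.1.natDegree = m ∧ P.2.degree < P.1.degree ∧
      IsCoprime P.1 P.2} × {h : F[X] // h.Monic ∧ h.natDegree = n - m} where
  toFun P := by
    refine ⟨⟨(P.1.1, P.1.2 %ₘ P.1.1), ?_⟩, ⟨P.1.2 /ₘ P.1.1, ?_⟩⟩ <;>
      obtain ⟨⟨f, g⟩, hf, hg, hfm, hgn, hc⟩ := P <;> dsimp only at *
    · refine ⟨hf, hfm, degree_modByMonic_lt g hf, ?_⟩
      rw [← modByMonic_add_div g f] at hc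
      exact IsCoprime.of_add_mul_left_right hc
    · refine ⟨?_, by rw [natDegree_divByMonic g hf, hfm, hgn]⟩
      have hd : f.degree ≤ g.degree := by
        rw [degree_eq_natDegree hf.ne_zero, degree_eq_natDegree hg.ne_zero, hfm, hgn]
        exact_mod_cast hmn.le
      rw [Monic, leadingCoeff_divByMonic_of_monic hf hd, hg]
  invFun P := by
    refine ⟨(P.1.1.1, P.1.1.1 * P.2.1 + P.1.1.2), ?_⟩
    obtain ⟨⟨⟨f, r⟩, hf, hfm, hr, hc⟩, ⟨h, hh, hhn⟩⟩ := P
    dsimp only at *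
    have hr' : r.degree < (f * h).degree :=
      hr.trans_le (degree_le_mul_left f hh.ne_zero)
    refine ⟨hf, (hf.mul hh).add_of_left hr', hfm, ?_, ?_⟩
    · rw [natDegree_add_eq_left_of_degree_lt hr', hf.natDegree_mul hh, hfm, hhn]
      omega
    · exact hc.mul_add_left_right h
  left_inv P := by
    ext1
    refine Prod.ext rfl ?_
    change P.1.1 * (P.1.2 /ₘ P.1.1) + P.1.2 %ₘ P.1.1 = P.1.2
    rw [add_comm, modByMonic_add_div]
  right_inv P := by
    obtain ⟨⟨⟨f, r⟩, hf, hfm, hr, hc⟩, ⟨h, hh, hhn⟩⟩ := P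
    have key := div_modByMonic_unique (f := f * h + r) h r hf ⟨add_comm _ _, hr⟩
    refine Prod.ext (Subtype.ext (Prod.ext rfl key.2)) (Subtype.ext key.1)

theorem IsCoprime.ne_zero_right_of_natDegree_pos {g r : F[X]} (h : IsCoprime g r)
    (hg : 0 < g.natDegree) : r ≠ 0 := by
  rintro rfl
  exact hg.ne' (natDegree_eq_zero_of_isUnit (isCoprime_zero_right.mp h))

/-- Normalizing the component of smaller degree of a coprime pair. -/
noncomputable def coprimePairsEquivUnitsProd {n : ℕ} (hn : 1 ≤ n) :
    {P : F[X] × F[X] // P.1.Monic ∧ P.1.natDegree = n ∧ P.2.degree < P.1.degree ∧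
      IsCoprime P.1 P.2} ≃
    Fˣ × {P : F[X] × F[X] // P.1.Monic ∧ P.2.Monic ∧ P.1.natDegree < n ∧
      P.2.natDegree = n ∧ IsCoprime P.1 P.2} where
  toFun P := by
    have hr : P.1.2 ≠ 0 := P.2.2.2.2.ne_zero_right_of_natDegree_pos (hn.trans_eq P.2.2.1.symm)
    refine ⟨Units.mk0 P.1.2.leadingCoeff (leadingCoeff_ne_zero.mpr hr),
      ⟨(P.1.2 * C P.1.2.leadingCoeff⁻¹, P.1.1), monic_mul_leadingCoeff_inv hr, P.2.1, ?_,
        P.2.2.1, ?_⟩⟩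
    · have h := natDegree_lt_natDegree hr P.2.2.2.1
      rw [P.2.2.1] at h
      rwa [natDegree_mul_C (inv_ne_zero (leadingCoeff_ne_zero.mpr hr))]
    · exact (isCoprime_mul_unit_right_left
        (isUnit_C.mpr (inv_ne_zero (leadingCoeff_ne_zero.mpr hr)).isUnit) _ _).mpr
          P.2.2.2.2.symm
  invFun P := by
    refine ⟨(P.2.1.2, P.2.1.1 * C (P.1 : F)), P.2.2.2.1, P.2.2.2.2.2.1, ?_, ?_⟩
    · rw [degree_mul_C P.1.ne_zero]
      refine degree_lt_degree ?_
      rw [P.2.2.2.2.2.1]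
      exact P.2.2.2.2.1
    · exact (isCoprime_mul_unit_right_right (isUnit_C.mpr P.1.isUnit) _ _).mpr
        P.2.2.2.2.2.2.symm
  left_inv P := by
    have hr : P.1.2 ≠ 0 := P.2.2.2.2.ne_zero_right_of_natDegree_pos (hn.trans_eq P.2.2.1.symm)
    refine Subtype.ext (Prod.ext rfl ?_)
    change P.1.2 * C P.1.2.leadingCoeff⁻¹ * C P.1.2.leadingCoeff = P.1.2
    rw [mul_assoc, ← C_mul, inv_mul_cancel₀ (leadingCoeff_ne_zero.mpr hr), C_1, mul_one]
  right_inv P := by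
    obtain ⟨u, ⟨⟨f, g⟩, hf, hg, hfn, hgn, hc⟩⟩ := P
    have hl : (f * C (u : F)).leadingCoeff = u := by
      rw [leadingCoeff_mul, leadingCoeff_C, hf, one_mul]
    refine Prod.ext (Units.ext hl) (Subtype.ext (Prod.ext ?_ rfl))
    change f * C (u : F) * C (f * C (u : F)).leadingCoeff⁻¹ = f
    rw [hl, mul_assoc, ← C_mul, mul_inv_cancel₀ u.ne_zero, C_1, mul_one]

/-- Sorting coprime monic pairs by the degree of the first component. -/
def coprimeMonicPairsEquivSigma (n : ℕ) :
    {P : F[X] × F[X] // P.1.Monic ∧ P.2.Monic ∧ P.1.natDegree < n ∧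
      P.2.natDegree = n ∧ IsCoprime P.1 P.2} ≃
    Σ m : Fin n, {P : F[X] × F[X] // P.1.Monic ∧ P.2.Monic ∧ P.1.natDegree = m ∧
      P.2.natDegree = n ∧ IsCoprime P.1 P.2} where
  toFun P := ⟨⟨P.1.1.natDegree, P.2.2.2.1⟩, P.1, P.2.1, P.2.2.1, rfl, P.2.2.2.2⟩
  invFun P := ⟨P.2.1, P.2.2.1, P.2.2.2.1, P.2.2.2.2.1.trans_lt P.1.2, P.2.2.2.2.2⟩
  left_inv _ := rfl
  right_inv := by
    rintro ⟨⟨m, hm⟩, ⟨P, h1, h2, h3, h4⟩⟩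
    dsimp only at h3
    subst h3
    rfl

theorem card_coprime_pairs_monic_left_zero :
    Nat.card {P : F[X] × F[X] // P.1.Monic ∧ P.1.natDegree = 0 ∧ P.2.degree < P.1.degree ∧
      IsCoprime P.1 P.2} = 1 := by
  rw [Nat.card_eq_one_iff_unique]
  refine ⟨⟨?_⟩, ⟨⟨(1, 0), monic_one, natDegree_one, by simp, isCoprime_one_left⟩⟩⟩
  have key : ∀ P : {P : F[X] × F[X] // P.1.Monic ∧ P.1.natDegree = 0 ∧
      P.2.degree < P.1.degree ∧ IsCoprime P.1 P.2}, P.1 = (1, 0) := by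
    rintro ⟨⟨g, r⟩, hg, hg0, hr, -⟩
    obtain rfl := hg.natDegree_eq_zero.mp hg0
    simp only [degree_one] at hr
    simp only [Prod.mk.injEq, true_and]
    rw [← degree_eq_bot]
    exact Nat.WithBot.lt_zero_iff.mp hr
  intro P Q
  exact Subtype.ext ((key P).trans (key Q).symm)

variable [Fintype F]

theorem Polynomial.finite_degreeLT (n : ℕ) : Finite (degreeLT F n) :=
  Finite.of_equiv _ (degreeLTEquiv F n).symm.toEquiv

theorem Polynomial.card_monic_natDegree_eq (n : ℕ) :
    Nat.card {p : F[X] // p.Monic ∧ p.natDegree = n} = Fintype.card F ^ n := by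
  rw [Nat.card_congr ((monicEquivDegreeLT n).trans (degreeLTEquiv F n).toEquiv)]
  simp

theorem finite_coprime_pairs_monic_left (n : ℕ) :
    Finite {P : F[X] × F[X] // P.1.Monic ∧ P.1.natDegree = n ∧ P.2.degree < P.1.degree ∧
      IsCoprime P.1 P.2} := by
  have := finite_degreeLT (F := F) (n + 1)
  refine Finite.of_injective (β := degreeLT F (n + 1) × degreeLT F (n + 1))
    (fun P => ⟨⟨P.1.1, ?_⟩, ⟨P.1.2, ?_⟩⟩) ?_
  · have h : P.1.1.degree < ((n + 1 : ℕ) : WithBot ℕ) := by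
      rw [degree_eq_natDegree P.2.1.ne_zero, P.2.2.1]
      exact_mod_cast n.lt_succ_self
    exact mem_degreeLT.mpr h
  · have h : P.1.1.degree < ((n + 1 : ℕ) : WithBot ℕ) := by
      rw [degree_eq_natDegree P.2.1.ne_zero, P.2.2.1]
      exact_mod_cast n.lt_succ_self
    exact mem_degreeLT.mpr (P.2.2.2.1.trans h)
  · intro P Q h
    simp only [Prod.mk.injEq, Subtype.mk.injEq] at h
    exact Subtype.ext (Prod.ext h.1 h.2)

theorem card_coprime_pairs_monic_left {n : ℕ} (hn : 1 ≤ n) :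
    Nat.card {P : F[X] × F[X] // P.1.Monic ∧ P.1.natDegree = n ∧ P.2.degree < P.1.degree ∧
      IsCoprime P.1 P.2} = (Fintype.card F - 1) *
    Nat.card {P : F[X] × F[X] // P.1.Monic ∧ P.2.Monic ∧ P.1.natDegree < n ∧
      P.2.natDegree = n ∧ IsCoprime P.1 P.2} := by
  rw [Nat.card_congr (coprimePairsEquivUnitsProd hn), Nat.card_prod, Nat.card_units,
    Nat.card_eq_fintype_card]

theorem card_coprime_monic_pairs_eq_sum (n : ℕ) :
    Nat.card {P : F[X] × F[X] // P.1.Monic ∧ P.2.Monic ∧ P.1.natDegree < n ∧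
      P.2.natDegree = n ∧ IsCoprime P.1 P.2} =
    ∑ m ∈ Finset.range n, Nat.card {P : F[X] × F[X] // P.1.Monic ∧ P.1.natDegree = m ∧
      P.2.degree < P.1.degree ∧ IsCoprime P.1 P.2} * Fintype.card F ^ (n - m) := by
  have hfin (m : Fin n) : Finite {P : F[X] × F[X] // P.1.Monic ∧ P.2.Monic ∧
      P.1.natDegree = m ∧ P.2.natDegree = n ∧ IsCoprime P.1 P.2} := by
    have := finite_coprime_pairs_monic_left (F := F) m
    have := finite_degreeLT (F := F) (n - m)
    have : Finite {h : F[X] // h.Monic ∧ h.natDegree = n - m} :=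
      Finite.of_equiv _ (monicEquivDegreeLT (n - m)).symm
    exact Finite.of_equiv _ (coprimeMonicPairsEquivDivMod m.2).symm
  rw [Nat.card_congr (coprimeMonicPairsEquivSigma n), Nat.card_sigma, Finset.sum_range]
  refine Finset.sum_congr rfl fun m _ => ?_
  rw [Nat.card_congr (coprimeMonicPairsEquivDivMod m.2), Nat.card_prod, card_monic_natDegree_eq]

theorem card_coprime_monic_pairs_succ {n : ℕ} (hn : 1 ≤ n) :
    Nat.card {P : F[X] × F[X] // P.1.Monic ∧ P.2.Monic ∧ P.1.natDegree < n + 1 ∧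
      P.2.natDegree = n + 1 ∧ IsCoprime P.1 P.2} =
    Fintype.card F ^ 2 * Nat.card {P : F[X] × F[X] // P.1.Monic ∧ P.2.Monic ∧
      P.1.natDegree < n ∧ P.2.natDegree = n ∧ IsCoprime P.1 P.2} := by
  have hstep : ∀ m ∈ Finset.range n, Nat.card {P : F[X] × F[X] // P.1.Monic ∧
      P.1.natDegree = m ∧ P.2.degree < P.1.degree ∧ IsCoprime P.1 P.2} *
        Fintype.card F ^ (n + 1 - m) = Nat.card {P : F[X] × F[X] // P.1.Monic ∧
      P.1.natDegree = m ∧ P.2.degree < P.1.degree ∧ IsCoprime P.1 P.2} *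
        Fintype.card F ^ (n - m) * Fintype.card F := by
    intro m hm
    rw [Nat.succ_sub (Finset.mem_range.mp hm).le, pow_succ, mul_assoc]
  rw [card_coprime_monic_pairs_eq_sum (n + 1), Finset.sum_range_succ,
    Finset.sum_congr rfl hstep, ← Finset.sum_mul, ← card_coprime_monic_pairs_eq_sum,
    card_coprime_pairs_monic_left hn]
  obtain ⟨k, hk⟩ := Nat.exists_eq_add_of_le' (Fintype.card_pos (α := F))
  rw [hk, Nat.add_sub_cancel, Nat.add_sub_cancel_left]
  ring

end EuclideanCounting

/-- Lemma A1 (second part): the number `α_n` of ordered pairs `(f, g)` of coprime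
monic polynomials over `F_q` with `deg f < n` and `deg g = n` equals `q^(2n-1)`. -/
theorem count_coprime_monic_pairs_lt (q n : ℕ) (hq : IsPrimePow q) (hn : 1 ≤ n)
    (F : Type*) [Field F] [Fintype F] (hF : Fintype.card F = q) :
    Nat.card {P : Polynomial F × Polynomial F //
        P.1.Monic ∧ P.2.Monic ∧ P.1.natDegree < n ∧ P.2.natDegree = n ∧
        IsCoprime P.1 P.2} = q ^ (2 * n - 1) := by
  subst hF
  induction n, hn using Nat.le_induction with
  | base =>
    rw [card_coprime_monic_pairs_eq_sum, Finset.sum_range_one,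
      card_coprime_pairs_monic_left_zero]
    simp
  | succ n hn ih =>
    rw [card_coprime_monic_pairs_succ hn, ih, ← pow_add]
    congr 1
    omega
end

section
/- Let q be a prime power and i ≥ 0. The number Θ_i of monic polynomials g ∈ F_{q^2}[X] of degree i with gcd(g, g̃) = 1 equals [(-1)^i·(1+q) + q^{2i+1}·(q-1)]/(1+q^2). -/
open Polynomial

/-- For `g ∈ F_{q^2}[X]`, `dualPoly q g = X^(deg g) · ḡ(1/X)`, where `ḡ` is
obtained from `g` by applying the Frobenius `x ↦ x^q` to the coefficients:
the coefficients of `g` are reversed and raised to the `q`-th power. -/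
noncomputable def dualPoly {E : Type*} [Field E] (q : ℕ) (g : Polynomial E) :
    Polynomial E :=
  ∑ i ∈ Finset.range (g.natDegree + 1),
    Polynomial.C (g.coeff i ^ q) * Polynomial.X ^ (g.natDegree - i)

/-- A nonzero polynomial `g ∈ F_{q^2}[X]` is self-dual if `g̃ = c·g` for some
`c ∈ F_{q^2}^*`. -/
def IsSelfDual {E : Type*} [Field E] (q : ℕ) (g : Polynomial E) : Prop :=
  ∃ c : E, c ≠ 0 ∧ dualPoly q g = Polynomial.C c * g

/-- The conjugate-reciprocal of a polynomial with respect to an endomorphism of the coefficients. -/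
noncomputable def conjReverse {E : Type*} [Field E] (φ : E →+* E) (g : E[X]) : E[X] :=
  (g.map φ).reverse

theorem dualPoly_eq_conjReverse {E : Type*} [Field E] {q : ℕ} {φ : E →+* E}
    (hφ : ∀ x, φ x = x ^ q) (g : E[X]) : dualPoly q g = conjReverse φ g := by
  ext n
  rw [dualPoly, conjReverse, coeff_reverse, natDegree_map, coeff_map, finsetSum_coeff]
  simp only [coeff_C_mul_X_pow]
  rcases le_or_gt n g.natDegree with h | h
  · rw [revAt_le h, Finset.sum_eq_single (g.natDegree - n), if_pos (by omega), hφ]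
    · intro b hb hne
      rw [Finset.mem_range] at hb
      rw [if_neg (by omega)]
    · intro hn
      exact absurd (Finset.mem_range.2 (by omega)) hn
  · rw [revAt_eq_self_of_lt h, coeff_eq_zero_of_natDegree_lt h, map_zero]
    exact Finset.sum_eq_zero fun b _ => if_neg (by omega)

namespace conjReverse

variable {E : Type*} [Field E] {φ : E →+* E}

theorem mul (f g : E[X]) : conjReverse φ (f * g) = conjReverse φ f * conjReverse φ g := by
  rw [conjReverse, Polynomial.map_mul, reverse_mul_of_domain]; rfl

theorem coeff_of_le {g : E[X]} {n : ℕ} (h : n ≤ g.natDegree) :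
    (conjReverse φ g).coeff n = φ (g.coeff (g.natDegree - n)) := by
  rw [conjReverse, coeff_reverse, natDegree_map, revAt_le h, coeff_map]

theorem coeff_zero (g : E[X]) : (conjReverse φ g).coeff 0 = φ g.leadingCoeff := by
  simp [conjReverse, coeff_zero_reverse]

theorem natDegree_le (g : E[X]) : (conjReverse φ g).natDegree ≤ g.natDegree :=
  (reverse_natDegree_le _).trans natDegree_map_le

theorem natDegree_of_coeff_zero_ne {g : E[X]} (h : g.coeff 0 ≠ 0) :
    (conjReverse φ g).natDegree = g.natDegree := by
  refine le_antisymm (natDegree_le g) (le_natDegree_of_ne_zero ?_)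
  rw [coeff_of_le le_rfl, Nat.sub_self]
  exact (map_ne_zero φ).2 h

theorem conjReverse_of_coeff_zero_ne (hφ : Function.Involutive φ) {g : E[X]}
    (h : g.coeff 0 ≠ 0) : conjReverse φ (conjReverse φ g) = g := by
  have hd := natDegree_of_coeff_zero_ne (φ := φ) h
  ext n
  rcases le_or_gt n g.natDegree with hn | hn
  · rw [coeff_of_le (hn.trans hd.ge), hd, coeff_of_le (Nat.sub_le _ _), hφ]
    congr 1
    omega
  · rw [coeff_eq_zero_of_natDegree_lt hn,
      coeff_eq_zero_of_natDegree_lt (((natDegree_le _).trans hd.le).trans_lt hn)]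

theorem conjReverse_dvd (hφ : Function.Involutive φ) (g : E[X]) :
    conjReverse φ (conjReverse φ g) ∣ g := by
  rcases eq_or_ne g 0 with rfl | hg
  · exact dvd_zero _
  obtain ⟨f, hf, hX⟩ := exists_eq_pow_rootMultiplicity_mul_and_not_dvd g hg 0
  rw [C_0, sub_zero] at hf hX
  have h1 : conjReverse φ g = conjReverse φ f := by
    rw [hf, conjReverse, Polynomial.map_mul, Polynomial.map_pow, map_X, reverse_X_pow_mul]; rfl
  rw [h1, conjReverse_of_coeff_zero_ne hφ (fun h => hX (X_dvd_iff.2 h)), hf]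
  exact dvd_mul_left _ _

end conjReverse

/-- If `d` is self-dual and `h` is coprime to its dual, then every common divisor of `d * h` and
its dual divides `d`. -/
theorem dvd_of_dvd_conjReverse_mul {E : Type*} [Field E] {φ : E →+* E} {d h e : E[X]} {c : E}
    (hd : conjReverse φ d = C c * d) (hh : IsCoprime h (conjReverse φ h))
    (h1 : e ∣ d * h) (h2 : e ∣ conjReverse φ (d * h)) : e ∣ d := by
  obtain ⟨a, b, hab⟩ := hh
  rw [conjReverse.mul, hd] at h2
  rcases eq_or_ne c 0 with rfl | hc
  · have hd0 : d = 0 := by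
      have := conjReverse.coeff_zero (φ := φ) d
      rw [hd] at this
      simpa using this.symm
    simp [hd0]
  have h3 : e ∣ d * conjReverse φ h := by
    have := h2.mul_left (C c⁻¹)
    rwa [mul_assoc, ← mul_assoc (C c⁻¹), ← C_mul, inv_mul_cancel₀ hc, C_1, one_mul] at this
  have : d = a * (d * h) + b * (d * conjReverse φ h) := by linear_combination (-d) * hab
  rw [this]
  exact dvd_add (h1.mul_left a) (h3.mul_left b)

theorem exists_selfDual_mul_coprime {E : Type*} [Field E] {φ : E →+* E}
    (hφ : Function.Involutive φ) {g : E[X]} (hg : g.Monic) :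
    ∃ d h : E[X], d.Monic ∧ (∃ c, c ≠ 0 ∧ conjReverse φ d = C c * d) ∧ h.Monic ∧
      IsCoprime h (conjReverse φ h) ∧ g = d * h := by
  classical
  set d := normalize (EuclideanDomain.gcd g (conjReverse φ g)) with hd
  have hassoc : Associated d (EuclideanDomain.gcd g (conjReverse φ g)) := normalize_associated _
  have hdg : d ∣ g := hassoc.dvd.trans (EuclideanDomain.gcd_dvd_left _ _)
  have hdg' : d ∣ conjReverse φ g := hassoc.dvd.trans (EuclideanDomain.gcd_dvd_right _ _)
  have hd0 : d.coeff 0 ≠ 0 := by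
    intro h0
    have := (X_dvd_iff.2 h0).trans hdg'
    rw [X_dvd_iff, conjReverse.coeff_zero, hg.leadingCoeff, map_one] at this
    exact one_ne_zero this
  have hdne : d ≠ 0 := by rintro h; simp [h] at hd0
  have hdm : d.Monic := by
    rw [hd]
    refine monic_normalize ?_
    intro h
    rw [hd, h] at hdne
    simp at hdne
  have hmono : ∀ {a b : E[X]}, a ∣ b → conjReverse φ a ∣ conjReverse φ b := by
    rintro a _ ⟨t, rfl⟩
    exact ⟨_, conjReverse.mul a t⟩
  have hDd : conjReverse φ d ∣ d :=
    (EuclideanDomain.dvd_gcd ((hmono hdg').trans (conjReverse.conjReverse_dvd hφ g))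
      (hmono hdg)).trans hassoc.symm.dvd
  have hdd : d ∣ conjReverse φ d := by
    have := hmono hDd
    rwa [conjReverse.conjReverse_of_coeff_zero_ne hφ hd0] at this
  obtain ⟨u, hu⟩ := associated_of_dvd_dvd hdd hDd
  obtain ⟨c, hc, hcu⟩ := Polynomial.isUnit_iff.1 u.isUnit
  obtain ⟨h, hgh⟩ := hdg
  have hsd : conjReverse φ d = C c * d := by rw [hcu, mul_comm, hu]
  refine ⟨d, h, hdm, ⟨c, hc.ne_zero, hsd⟩, hdm.of_mul_monic_left (hgh ▸ hg), ?_, hgh⟩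
  obtain ⟨v, hv⟩ := hassoc.symm
  have hbez := EuclideanDomain.gcd_eq_gcd_ab g (conjReverse φ g)
  refine ⟨v * EuclideanDomain.gcdA g (conjReverse φ g),
    v * C c * EuclideanDomain.gcdB g (conjReverse φ g), mul_left_cancel₀ hdne ?_⟩
  have hDg : conjReverse φ g = C c * d * conjReverse φ h := by rw [hgh, conjReverse.mul, hsd]
  linear_combination (-v * EuclideanDomain.gcdA g (conjReverse φ g) : E[X]) * hgh -
    (v * EuclideanDomain.gcdB g (conjReverse φ g) : E[X]) * hDg - (v : E[X]) * hbez + hv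

/-- Monic self-dual polynomials of degree `j`. -/
abbrev MonicSelfDual {E : Type*} [Field E] (φ : E →+* E) (j : ℕ) : Type _ :=
  {g : E[X] // g.Monic ∧ g.natDegree = j ∧ ∃ c, c ≠ 0 ∧ conjReverse φ g = C c * g}

/-- Monic polynomials of degree `j` coprime to their dual. -/
abbrev MonicCoprimeDual {E : Type*} [Field E] (φ : E →+* E) (j : ℕ) : Type _ :=
  {g : E[X] // g.Monic ∧ g.natDegree = j ∧ IsCoprime g (conjReverse φ g)}

section Count

variable {E : Type*} [Field E]

/-- Monic polynomials of degree `n` correspond to their lower coefficients. -/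
noncomputable def monicEquivFun (n : ℕ) : {g : E[X] // g.Monic ∧ g.natDegree = n} ≃ (Fin n → E) :=
  (monicEquivDegreeLT n).trans (degreeLTEquiv E n).toEquiv

theorem monicEquivFun_apply {n : ℕ} (g : {g : E[X] // g.Monic ∧ g.natDegree = n}) (k : Fin n) :
    monicEquivFun n g k = g.1.coeff k := by
  obtain ⟨g, hg, rfl⟩ := g
  have hk := k.2
  simp [monicEquivFun, monicEquivDegreeLT, degreeLTEquiv, eraseLead_coeff, hk.ne]

variable [Finite E]

instance (n : ℕ) : Finite {g : E[X] // g.Monic ∧ g.natDegree = n} :=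
  .of_equiv _ (monicEquivFun n).symm

instance finite_monic_subtype (n : ℕ) (P : E[X] → Prop) :
    Finite {g : E[X] // g.Monic ∧ g.natDegree = n ∧ P g} :=
  Finite.of_injective
    (fun g => (⟨g.1, g.2.1, g.2.2.1⟩ : {g : E[X] // g.Monic ∧ g.natDegree = n}))
    fun _ _ h => Subtype.ext (congrArg (fun x => x.1) h)

theorem sum_card_selfDual_mul_card_coprime {φ : E →+* E} (hφ : Function.Involutive φ) (n : ℕ) :
    ∑ p ∈ Finset.HasAntidiagonal.antidiagonal n,
        Nat.card (MonicSelfDual φ p.1) * Nat.card (MonicCoprimeDual φ p.2) =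
      Nat.card E ^ n := by
  rw [← Finset.sum_coe_sort]
  simp only [← Nat.card_prod]
  rw [← Nat.card_sigma (β := fun p : Finset.HasAntidiagonal.antidiagonal n =>
    MonicSelfDual φ p.1.1 × MonicCoprimeDual φ p.1.2)]
  have hcard : Nat.card E ^ n = Nat.card {g : E[X] // g.Monic ∧ g.natDegree = n} := by
    rw [Nat.card_congr (monicEquivFun n), Nat.card_fun, Nat.card_fin]
  rw [hcard]
  have hdeg : ∀ x : (p : Finset.HasAntidiagonal.antidiagonal n) × MonicSelfDual φ p.1.1 × MonicCoprimeDual φ p.1.2,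
      (x.2.1.1 * x.2.2.1).natDegree = n := by
    intro x
    rw [x.2.1.2.1.natDegree_mul x.2.2.2.1, x.2.1.2.2.1, x.2.2.2.2.1]
    exact Finset.HasAntidiagonal.mem_antidiagonal.1 x.1.2
  refine Nat.card_eq_of_bijective (fun x => ⟨x.2.1.1 * x.2.2.1, x.2.1.2.1.mul x.2.2.2.1, hdeg x⟩)
    ⟨?_, ?_⟩
  · rintro ⟨⟨⟨_, _⟩, hab⟩, ⟨d, hd, hda, c, hc, hdc⟩, ⟨h, hh, hhb, hhc⟩⟩
      ⟨⟨⟨_, _⟩, hab'⟩, ⟨d', hd', hda', c', hc', hdc'⟩, ⟨h', hh', hhb', hhc'⟩⟩ heq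
    have heq : d * h = d' * h' := congrArg (fun x => x.1) heq
    dsimp only at hda hda' hhb hhb'
    have key : ∀ {d h : E[X]} {c : E}, conjReverse φ d = C c * d →
        d ∣ d * h ∧ d ∣ conjReverse φ (d * h) := by
      intro d h c hdc
      refine ⟨dvd_mul_right _ _, ?_⟩
      rw [conjReverse.mul, hdc]
      exact (dvd_mul_left _ _).mul_right _
    have h1 : d ∣ d' := dvd_of_dvd_conjReverse_mul hdc' hhc' (heq ▸ (key hdc).1)
      (heq ▸ (key hdc).2)
    have h2 : d' ∣ d := dvd_of_dvd_conjReverse_mul hdc hhc (heq ▸ (key hdc').1)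
      (heq ▸ (key hdc').2)
    obtain rfl := eq_of_monic_of_associated hd hd' (associated_of_dvd_dvd h1 h2)
    obtain rfl := mul_left_cancel₀ hd.ne_zero heq
    subst hda hhb hda' hhb'
    rfl
  · rintro ⟨g, hg, rfl⟩
    obtain ⟨d, h, hd, hdc, hh, hhc, rfl⟩ := exists_selfDual_mul_coprime hφ hg
    exact ⟨⟨⟨(d.natDegree, h.natDegree), Finset.HasAntidiagonal.mem_antidiagonal.2 (hd.natDegree_mul hh).symm⟩,
      ⟨d, hd, rfl, hdc⟩, ⟨h, hh, rfl, hhc⟩⟩, rfl⟩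

end Count

section Twisted

variable {E : Type*} [Field E]

theorem card_fixed_twist [Finite E] {q : ℕ} (hq : 1 < q) (hE : Nat.card E = q ^ 2) {φ : E →+* E}
    (hφq : ∀ x, φ x = x ^ q) (hφ : Function.Involutive φ) {c : E} (hc : φ c * c = 1) :
    Nat.card {x : E // φ x = c * x} = q := by
  classical
  have hle : ∀ b : E, Nat.card {x : E // φ x = b * x} ≤ q := by
    intro b
    have hdeg : (X ^ q - C b * X : E[X]).natDegree = q := by
      rw [natDegree_sub_eq_left_of_natDegree_lt] <;> rw [natDegree_X_pow]
      exact (((natDegree_C_mul_le b X).trans natDegree_X_le)).trans_lt hq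
    have hne : (X ^ q - C b * X : E[X]) ≠ 0 := by
      intro h
      rw [h, natDegree_zero] at hdeg
      omega
    rw [Nat.subtype_card (X ^ q - C b * X : E[X]).roots.toFinset]
    · exact ((Multiset.toFinset_card_le _).trans (card_roots' _)).trans hdeg.le
    · intro x
      simp [hne, hφq, sub_eq_zero]
  let L : E →+ E := (φ : E →+ E) - AddMonoidHom.mulLeft c
  have hL : ∀ x, L x = φ x - c * x := fun x => rfl
  have hker : Nat.card L.ker = Nat.card {x : E // φ x = c * x} :=
    Nat.card_congr (Equiv.subtypeEquivRight fun x => by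
      rw [AddMonoidHom.mem_ker, hL, sub_eq_zero])
  have hmem : ∀ y ∈ L.range, φ y = -φ c * y := by
    rintro _ ⟨x, rfl⟩
    simp only [hL, map_sub, map_mul, hφ x]
    linear_combination (-x) * hc
  have hrange : Nat.card L.range ≤ q :=
    (Nat.card_le_card_of_injective
      (fun y : L.range => (⟨y.1, hmem _ y.2⟩ : {x : E // φ x = -φ c * x}))
      fun a b h => Subtype.ext (congrArg (fun x => x.1) h)).trans (hle _)
  have hmul : Nat.card L.ker * Nat.card L.range = q ^ 2 := by
    rw [← hE, ← AddSubgroup.card_mul_index L.ker, AddSubgroup.index_ker]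
  have h1 := hle c
  rw [← hker] at h1 ⊢
  nlinarith

/-- Functions on `Fin n` that are `c`-semi-invariant under conjugate reversal. -/
abbrev TwistedFun (φ : E →+* E) (c : E) (n : ℕ) : Type _ :=
  {a : Fin n → E // ∀ k, φ (a k.rev) = c * a k}

/-- The outer entries of a twisted function are determined by the first one. -/
def twistedFunEquiv {φ : E →+* E} (hφ : Function.Involutive φ) {c : E} (hc : φ c * c = 1) (n : ℕ) :
    TwistedFun φ c (n + 2) ≃ E × TwistedFun φ c n where
  toFun a := (a.1 0, ⟨fun k => a.1 k.castSucc.succ, fun k => by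
    have := a.2 k.castSucc.succ
    rwa [Fin.rev_succ, Fin.rev_castSucc, ← Fin.succ_castSucc] at this⟩)
  invFun p := ⟨Fin.cons p.1 (Fin.snoc (α := fun _ => E) p.2.1 (φ c * φ p.1)), by
    intro k
    refine Fin.cases ?_ (fun k => Fin.lastCases ?_ (fun k => ?_) k) k
    · rw [Fin.rev_zero, ← Fin.succ_last]
      simp only [Fin.cons_succ, Fin.snoc_last, Fin.cons_zero, map_mul]
      rw [hφ, hφ]
    · rw [Fin.succ_last, Fin.rev_last, ← Fin.succ_last]
      simp only [Fin.cons_succ, Fin.snoc_last, Fin.cons_zero]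
      linear_combination (-φ p.1) * hc
    · rw [Fin.rev_succ, Fin.rev_castSucc, ← Fin.succ_castSucc]
      simp only [Fin.cons_succ, Fin.snoc_castSucc]
      exact p.2.2 k⟩
  left_inv a := by
    refine Subtype.ext (funext fun k => ?_)
    refine Fin.cases ?_ (fun k => Fin.lastCases ?_ (fun k => ?_) k) k
    · simp
    · simp only [Fin.cons_succ, Fin.snoc_last]
      have := a.2 (Fin.last _)
      rw [Fin.rev_last] at this
      rw [this, Fin.succ_last]
      linear_combination (a.1 (Fin.last _)) * hc
    · simp
  right_inv p := by
    ext <;> simp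

theorem card_twistedFun [Finite E] {q : ℕ} (hq : 1 < q) (hE : Nat.card E = q ^ 2) {φ : E →+* E}
    (hφq : ∀ x, φ x = x ^ q) (hφ : Function.Involutive φ) {c : E} (hc : φ c * c = 1) (n : ℕ) :
    Nat.card (TwistedFun φ c n) = q ^ n := by
  induction n using Nat.twoStepInduction with
  | zero =>
    have : Unique (TwistedFun φ c 0) := ⟨⟨⟨Fin.elim0, fun k => k.elim0⟩⟩,
      fun a => Subtype.ext (Subsingleton.elim _ _)⟩
    simp
  | one =>
    rw [pow_one, ← card_fixed_twist hq hE hφq hφ hc]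
    refine Nat.card_congr ((Equiv.funUnique (Fin 1) E).subtypeEquiv fun a => ?_)
    simp
  | more n ih _ =>
    rw [Nat.card_congr (twistedFunEquiv hφ hc n), Nat.card_prod, ih, hE]
    ring

theorem card_norm_one [Finite E] {q : ℕ} (hq : 1 < q) (hE : Nat.card E = q ^ 2) {φ : E →+* E}
    (hφq : ∀ x, φ x = x ^ q) :
    Nat.card {c : E // φ c * c = 1} = q + 1 := by
  have h := IsCyclic.card_powMonoidHom_ker (G := Eˣ) (q + 1)
  rw [Nat.card_units, hE, Nat.gcd_eq_right ⟨q - 1, by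
    obtain ⟨r, rfl⟩ := Nat.exists_eq_add_of_lt hq
    rw [Nat.sub_eq_iff_eq_add (Nat.one_le_pow _ _ (by omega))]
    simp only [Nat.add_sub_cancel]
    ring⟩] at h
  rw [← h]
  have hmem : ∀ x : Eˣ, x ∈ (powMonoidHom (q + 1) : Eˣ →* Eˣ).ker ↔ φ x * x = 1 := by
    intro x
    rw [MonoidHom.mem_ker, powMonoidHom_apply, Units.ext_iff, hφq, ← pow_succ]
    simp
  refine (Nat.card_eq_of_bijective (fun x => ⟨x.1.1, (hmem _).1 x.2⟩) ⟨?_, ?_⟩).symm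
  · intro a b h
    exact Subtype.ext (Units.ext (congrArg (fun x => x.1) h))
  · rintro ⟨c, hc⟩
    have hc0 : c ≠ 0 := by rintro rfl; simp at hc
    exact ⟨⟨Units.mk0 c hc0, (hmem _).2 hc⟩, rfl⟩

end Twisted

section SelfDualCount

variable {E : Type*} [Field E]

theorem exists_conjReverse_eq_iff_coeff {φ : E →+* E} {m : ℕ} {g : E[X]}
    (hg : g.Monic) (hm : g.natDegree = m + 1) :
    (∃ c, c ≠ 0 ∧ conjReverse φ g = C c * g) ↔
      φ (g.coeff 0) * g.coeff 0 = 1 ∧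
        ∀ k < m, φ (g.coeff (m - k)) = φ (g.coeff 0) * g.coeff (k + 1) := by
  have hlead : g.coeff (m + 1) = 1 := by rw [← hm]; exact hg.coeff_natDegree
  have hcoeff : ∀ n ≤ m + 1, (conjReverse φ g).coeff n = φ (g.coeff (m + 1 - n)) := by
    intro n hn
    rw [conjReverse.coeff_of_le (hn.trans hm.ge), hm]
  constructor
  · rintro ⟨c, -, h⟩
    have hc : φ (g.coeff 0) = c := by
      have := hcoeff (m + 1) le_rfl
      rwa [h, coeff_C_mul, hlead, mul_one, Nat.sub_self, eq_comm] at this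
    constructor
    · have := hcoeff 0 (Nat.zero_le _)
      rwa [h, coeff_C_mul, Nat.sub_zero, hlead, map_one, ← hc] at this
    · intro k hk
      have := hcoeff (k + 1) (by omega)
      rwa [h, coeff_C_mul, ← hc, Nat.add_sub_add_right, eq_comm] at this
  · rintro ⟨h0, h1⟩
    refine ⟨φ (g.coeff 0), left_ne_zero_of_mul_eq_one h0, ?_⟩
    ext n
    rw [coeff_C_mul]
    rcases le_or_gt n (m + 1) with hn | hn
    · rw [hcoeff n hn]
      rcases n with _ | k
      · rw [Nat.sub_zero, hlead, map_one, h0]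
      · rw [Nat.add_sub_add_right]
        rcases (Nat.le_of_succ_le_succ hn).lt_or_eq with hk | rfl
        · exact h1 k hk
        · rw [Nat.sub_self, hlead, mul_one]
    · rw [coeff_eq_zero_of_natDegree_lt (hm.trans_lt hn), mul_zero,
        coeff_eq_zero_of_natDegree_lt ((conjReverse.natDegree_le g).trans_lt (hm.trans_lt hn))]

/-- A monic self-dual polynomial of positive degree is given by the conjugate of its constant
coefficient and by its middle coefficients. -/
theorem card_monicSelfDual_succ {φ : E →+* E} (m : ℕ) :
    Nat.card (MonicSelfDual φ (m + 1)) =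
      Nat.card ((c : {c : E // φ c * c = 1}) × TwistedFun φ (φ c.1) m) := by
  refine Nat.card_eq_of_bijective (fun g =>
    have h := (exists_conjReverse_eq_iff_coeff g.2.1 g.2.2.1).1 g.2.2.2
    ⟨⟨g.1.coeff 0, h.1⟩, fun k => g.1.coeff (k + 1), fun k => by
      have := h.2 k k.2
      rwa [← show (k.rev : ℕ) + 1 = m - k by rw [Fin.val_rev]; omega] at this⟩) ⟨?_, ?_⟩
  · rintro ⟨f, hf, hfm, hfc⟩ ⟨g, hg, hgm, hgc⟩ h
    have h0 : f.coeff 0 = g.coeff 0 := congrArg (fun s => s.1.1) h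
    have h1 : ∀ k : Fin m, f.coeff (k + 1) = g.coeff (k + 1) :=
      congrFun (congrArg (fun s => s.2.1) h)
    have key := (monicEquivFun (m + 1)).injective (a₁ := ⟨f, hf, hfm⟩) (a₂ := ⟨g, hg, hgm⟩) <| by
      ext k
      rw [monicEquivFun_apply, monicEquivFun_apply]
      refine Fin.cases ?_ (fun k => ?_) k
      · exact h0
      · exact h1 k
    exact Subtype.ext (congrArg (fun x => x.1) key)
  · rintro ⟨⟨c, hc⟩, a, ha⟩
    obtain ⟨g, hg⟩ := (monicEquivFun (m + 1)).surjective (Fin.cons c a)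
    have hcoeff : ∀ k : Fin (m + 1), g.1.coeff k = (Fin.cons c a : Fin (m + 1) → E) k := by
      intro k
      rw [← monicEquivFun_apply, hg]
    clear hg
    have h0 : g.1.coeff 0 = c := hcoeff 0
    have h1 : ∀ k : Fin m, g.1.coeff (k + 1) = a k := fun k => hcoeff k.succ
    have hsd := (exists_conjReverse_eq_iff_coeff g.2.1 g.2.2).2 ⟨by rw [h0]; exact hc, fun k hk => by
      have := ha ⟨k, hk⟩
      rw [← h1, ← h1, Fin.val_rev] at this
      rw [h0, ← this]
      congr 2
      dsimp only
      omega⟩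
    refine ⟨⟨g.1, g.2.1, g.2.2, hsd⟩, ?_⟩
    obtain rfl := h0
    obtain rfl : (fun k : Fin m => g.1.coeff (k + 1)) = a := funext h1
    rfl

theorem card_monicSelfDual [Finite E] {q : ℕ} (hq : 1 < q) (hE : Nat.card E = q ^ 2)
    {φ : E →+* E} (hφq : ∀ x, φ x = x ^ q) (hφ : Function.Involutive φ) (m : ℕ) :
    Nat.card (MonicSelfDual φ (m + 1)) = (q + 1) * q ^ m := by
  have := Fintype.ofFinite {c : E // φ c * c = 1}
  rw [card_monicSelfDual_succ, Nat.card_sigma]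
  have : ∀ c : {c : E // φ c * c = 1}, Nat.card (TwistedFun φ (φ c.1) m) = q ^ m := fun c =>
    card_twistedFun hq hE hφq hφ (by rw [hφ, mul_comm, c.2]) m
  simp only [this, Finset.sum_const, Finset.card_univ, smul_eq_mul]
  rw [← Nat.card_eq_fintype_card, card_norm_one hq hE hφq]

theorem card_monicSelfDual_zero {φ : E →+* E} : Nat.card (MonicSelfDual φ 0) = 1 := by
  rw [Nat.card_eq_one_iff_unique]
  refine ⟨⟨fun f g => Subtype.ext ?_⟩, ⟨1, monic_one, natDegree_one, 1, one_ne_zero, ?_⟩⟩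
  · rw [f.2.1.natDegree_eq_zero.1 f.2.2.1, g.2.1.natDegree_eq_zero.1 g.2.2.1]
  · rw [conjReverse, Polynomial.map_one, C_1, mul_one, ← C_1, reverse_C]

theorem card_monicCoprimeDual_zero {φ : E →+* E} : Nat.card (MonicCoprimeDual φ 0) = 1 := by
  rw [Nat.card_eq_one_iff_unique]
  refine ⟨⟨fun f g => Subtype.ext ?_⟩, ⟨1, monic_one, natDegree_one, isCoprime_one_left⟩⟩
  rw [f.2.1.natDegree_eq_zero.1 f.2.2.1, g.2.1.natDegree_eq_zero.1 g.2.2.1]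

theorem card_monicCoprimeDual_succ_add [Finite E] {q : ℕ} (hq : 1 < q) (hE : Nat.card E = q ^ 2)
    {φ : E →+* E} (hφq : ∀ x, φ x = x ^ q) (hφ : Function.Involutive φ) (n : ℕ) :
    Nat.card (MonicCoprimeDual φ (n + 1)) + Nat.card (MonicCoprimeDual φ n) + q * (q ^ 2) ^ n =
      (q ^ 2) ^ (n + 1) := by
  rw [← hE, ← sum_card_selfDual_mul_card_coprime hφ, ← sum_card_selfDual_mul_card_coprime hφ,
    Finset.Nat.sum_antidiagonal_succ, card_monicSelfDual_zero, one_mul, add_assoc]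
  congr 1
  simp only [card_monicSelfDual hq hE hφq hφ]
  rcases n with _ | n
  · simp [card_monicSelfDual_zero, card_monicCoprimeDual_zero]
    ring
  · rw [Finset.Nat.sum_antidiagonal_succ, Finset.Nat.sum_antidiagonal_succ,
      card_monicSelfDual_zero, mul_add, ← add_assoc, Finset.mul_sum]
    congr 1
    · ring
    · refine Finset.sum_congr rfl fun p _ => ?_
      rw [card_monicSelfDual hq hE hφq hφ]
      ring

end SelfDualCount

theorem exists_ringHom_eq_pow {E : Type*} [Field E] [Fintype E] {q : ℕ} (hq : IsPrimePow q)
    (hE : Fintype.card E = q ^ 2) :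
    ∃ φ : E →+* E, (∀ x, φ x = x ^ q) ∧ Function.Involutive φ := by
  obtain ⟨p, k, hp, hk, rfl⟩ := hq
  have : Fact p.Prime := ⟨hp.nat_prime⟩
  have : CharP E p := charP_of_card_eq_prime_pow (f := k * 2) (by rw [hE, pow_mul])
  refine ⟨iterateFrobenius E p k, fun x => rfl, fun x => ?_⟩
  rw [iterateFrobenius_def, iterateFrobenius_def, ← pow_mul, ← sq, ← hE, FiniteField.pow_card]

/-- Lemma A4 (second part): the number `Θ_i` of monic polynomials `g` of degree `i`
in `F_{q^2}[X]` with `gcd(g, g̃) = 1`. -/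
theorem count_coprime_dual (q i : ℕ) (hq : IsPrimePow q)
    (E : Type*) [Field E] [Fintype E] (hE : Fintype.card E = q ^ 2) :
    (Nat.card {g : Polynomial E //
        g.Monic ∧ g.natDegree = i ∧ IsCoprime g (dualPoly q g)} : ℚ) =
      ((-1 : ℚ) ^ i * (1 + (q : ℚ)) + (q : ℚ) ^ (2 * i + 1) * ((q : ℚ) - 1)) /
        (1 + (q : ℚ) ^ 2) := by
  obtain ⟨φ, hφq, hφ⟩ := exists_ringHom_eq_pow hq hE
  simp only [dualPoly_eq_conjReverse hφq]
  rw [Fintype.card_eq_nat_card] at hE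
  rw [eq_div_iff (by positivity)]
  induction i with
  | zero =>
    rw [card_monicCoprimeDual_zero]
    push_cast
    ring
  | succ n ih =>
    have h := congrArg (Nat.cast (R := ℚ)) (card_monicCoprimeDual_succ_add hq.one_lt hE hφq hφ n)
    push_cast at h
    rw [eq_sub_of_add_eq (eq_sub_of_add_eq h), sub_mul, ih]
    ring
end
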